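/- Let f : ℝⁿ × ℝᵐ → ℝⁿ be continuously differentiable with f(0,0) = 0, let A := ∂f/∂x(0,0), B := ∂f/∂u(0,0), and suppose the pair (A,B) is controllable. Fix any experiment (x₀, u(0),…,u(T−1)) whose input is persistently exciting of order n+1. Then there exists ε̄ > 0 such that for all ε ∈ (0, ε̄), with data matrices Ũ₀, X̃₀, X̃₁ from the scaled experiment (εx₀, εu(0),…,εu(T−1)) on the nonlinear system: (i) [Ũ₀; X̃₀] has full row rank m+n and X̃₁ has full row rank n; (ii) there exists a feasible pair (Q, α) with α > 0 for the data LMIs built from (X̃₀, X̃₁); and (iii) any pair (Q*, α*) attaining the maximal α among feasible pairs with α > 0 is such that X̃₀Q* is invertible and the gain K := Ũ₀Q*(X̃₀Q*)⁻¹ locally exponentially stabilizes the origin of x(k+1) = f(x(k), Kx(k)). -/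

import Mathlib

open Matrix
section helpers

open Filter Topology

lemma aux_rank_right_inv {p q : Type*} [Fintype p] [Fintype q] [DecidableEq p]
    (M : Matrix p q ℝ) (h : M.rank = Fintype.card p) : ∃ G : Matrix q p ℝ, M * G = 1 := by
  classical
  rw [← Matrix.mulVec_surjective_iff_exists_right_inverse]
  have h2 : LinearMap.range M.mulVecLin = ⊤ := by
    apply Submodule.eq_top_of_finrank_eq
    rw [Module.finrank_fintype_fun_eq_card]; exact h
  exact LinearMap.range_eq_top.mp h2

lemma aux_right_inv_ker {p q : Type*} [Fintype p] [Fintype q] [DecidableEq p]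
    (M : Matrix p q ℝ) (G : Matrix q p ℝ) (h : M * G = 1) (v : p → ℝ) (hv : v ᵥ* M = 0) :
    v = 0 := by
  have : v ᵥ* (M * G) = 0 := by rw [← Matrix.vecMul_vecMul, hv, Matrix.zero_vecMul]
  simpa [h] using this

lemma aux_ker_rank {p q : Type*} [Fintype p] [Fintype q]
    (M : Matrix p q ℝ) (h : ∀ v, v ᵥ* M = 0 → v = 0) : M.rank = Fintype.card p := by
  apply LinearIndependent.rank_matrix
  rw [← Matrix.vecMul_injective_iff]
  intro a b hab
  have := h (a - b) (by rw [Matrix.sub_vecMul]; exact sub_eq_zero.mpr hab)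
  exact sub_eq_zero.mp this

/-- Positive definiteness is open among symmetric matrices. -/
lemma aux_posDef_open {ι : Type*} [Fintype ι] (M : Matrix ι ι ℝ) (hM : M.PosDef) :
    ∀ᶠ N in 𝓝 M, N.IsHermitian → N.PosDef := by
  have h1 : ∀ᶠ N in 𝓝 M, ∀ x ∈ Metric.sphere (0 : ι → ℝ) 1, 0 < x ⬝ᵥ (N *ᵥ x) := by
    apply (isCompact_sphere (0 : ι → ℝ) 1).eventually_forall_of_forall_eventually
    intro x hx
    have hx0 : x ≠ 0 := by
      rintro rfl
      simp at hx
    have hc : Continuous fun z : Matrix ι ι ℝ × (ι → ℝ) => z.2 ⬝ᵥ (z.1 *ᵥ z.2) := by fun_prop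
    have := hM.dotProduct_mulVec_pos hx0
    rw [star_trivial] at this
    exact hc.continuousAt.eventually (lt_mem_nhds this)
  filter_upwards [h1] with N hN hH
  refine Matrix.PosDef.of_dotProduct_mulVec_pos hH ?_
  intro x hx
  rw [star_trivial]
  have hn : 0 < ‖x‖ := norm_pos_iff.mpr hx
  have := hN (‖x‖⁻¹ • x) (by simp [norm_smul, hn.ne'])
  rw [Matrix.mulVec_smul, smul_dotProduct, dotProduct_smul, smul_eq_mul, smul_eq_mul] at this
  have h2 : 0 < ‖x‖⁻¹ := inv_pos.mpr hn
  exact (mul_pos_iff_of_pos_left h2).mp ((mul_pos_iff_of_pos_left h2).mp this)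

lemma aux_posDef_coercive {ι : Type*} [Fintype ι] (M : Matrix ι ι ℝ) (hM : M.PosDef) :
    ∃ c > 0, ∀ x : ι → ℝ, c * ‖x‖ ^ 2 ≤ x ⬝ᵥ (M *ᵥ x) := by
  have hc : ContinuousOn (fun x : (ι → ℝ) => x ⬝ᵥ (M *ᵥ x)) (Metric.sphere (0 : ι → ℝ) 1) := by
    fun_prop
  have key : ∃ c > 0, ∀ x ∈ Metric.sphere (0 : ι → ℝ) 1, c ≤ x ⬝ᵥ (M *ᵥ x) := by
    by_cases hne : (Metric.sphere (0 : ι → ℝ) 1).Nonempty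
    · obtain ⟨y, hy, hmin⟩ := (isCompact_sphere (0 : ι → ℝ) 1).exists_isMinOn hne hc
      have hy0 : y ≠ 0 := by
        rintro rfl
        simp at hy
      refine ⟨_, ?_, fun x hx => hmin hx⟩
      simpa using hM.dotProduct_mulVec_pos hy0
    · exact ⟨1, one_pos, fun x hx => absurd ⟨x, hx⟩ hne⟩
  obtain ⟨c, hc0, hcx⟩ := key
  refine ⟨c, hc0, fun x => ?_⟩
  by_cases hx : x = 0
  · simp [hx]
  have hn : 0 < ‖x‖ := norm_pos_iff.mpr hx
  have := hcx (‖x‖⁻¹ • x) (by simp [norm_smul, hn.ne'])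
  rw [Matrix.mulVec_smul, smul_dotProduct, dotProduct_smul, smul_eq_mul, smul_eq_mul] at this
  have h3 := mul_le_mul_of_nonneg_right this (sq_nonneg ‖x‖)
  refine h3.trans (le_of_eq ?_)
  field_simp

lemma aux_bilin_bound {ι : Type*} [Fintype ι] (M : Matrix ι ι ℝ) :
    ∃ C > 0, ∀ x y : ι → ℝ, |x ⬝ᵥ (M *ᵥ y)| ≤ C * ‖x‖ * ‖y‖ := by
  refine ⟨(∑ i, ∑ j, |M i j|) + 1, by positivity, fun x y => ?_⟩
  have : |x ⬝ᵥ (M *ᵥ y)| ≤ ∑ i, ∑ j, |M i j| * (‖x‖ * ‖y‖) := by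
    simp only [dotProduct, mulVec]
    refine (Finset.abs_sum_le_sum_abs _ _).trans (Finset.sum_le_sum fun i _ => ?_)
    rw [Finset.mul_sum]
    refine (Finset.abs_sum_le_sum_abs _ _).trans (Finset.sum_le_sum fun j _ => ?_)
    have hx := norm_le_pi_norm x i
    have hy := norm_le_pi_norm y j
    rw [Real.norm_eq_abs] at hx hy
    rw [abs_mul, abs_mul]
    calc |x i| * (|M i j| * |y j|) = |M i j| * (|x i| * |y j|) := by ring
      _ ≤ _ := by gcongr
  refine this.trans ?_
  simp only [← Finset.sum_mul]
  have : 0 ≤ ‖x‖ * ‖y‖ := by positivity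
  nlinarith

lemma aux_block_form {p q : Type*} [Fintype p] [Fintype q] (A : Matrix p p ℝ) (B : Matrix p q ℝ)
    (C : Matrix q p ℝ) (D : Matrix q q ℝ) (a : p → ℝ) (b : q → ℝ) :
    Sum.elim a b ⬝ᵥ (fromBlocks A B C D *ᵥ Sum.elim a b) =
      a ⬝ᵥ (A *ᵥ a) + a ⬝ᵥ (B *ᵥ b) + (b ⬝ᵥ (C *ᵥ a) + b ⬝ᵥ (D *ᵥ b)) := by
  rw [fromBlocks_mulVec, sumElim_dotProduct_sumElim]
  simp [dotProduct_add]

/-- The quadratic form of `Y Yᵀ`. -/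
lemma aux_gram {p q : Type*} [Fintype p] [Fintype q] (Y : Matrix p q ℝ) (a : p → ℝ) :
    a ⬝ᵥ ((Y * Yᵀ) *ᵥ a) = (Yᵀ *ᵥ a) ⬝ᵥ (Yᵀ *ᵥ a) := by
  rw [← Matrix.mulVec_mulVec, Matrix.dotProduct_mulVec, ← Matrix.mulVec_transpose]

lemma aux_adj {p q : Type*} [Fintype p] [Fintype q] (Y : Matrix p q ℝ) (a : p → ℝ) (b : q → ℝ) :
    a ⬝ᵥ (Y *ᵥ b) = (Yᵀ *ᵥ a) ⬝ᵥ b := by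
  rw [Matrix.dotProduct_mulVec, ← Matrix.mulVec_transpose]

/-- Deadbeat construction: a solution of the Lyapunov LMI from controllability. -/
lemma aux_lyap {n m : ℕ} (A : Matrix (Fin n) (Fin n) ℝ) (B : Matrix (Fin n) (Fin m) ℝ)
    (hctrb : (Matrix.of fun (i : Fin n) (p : Fin n × Fin m) =>
        (A ^ (p.1 : ℕ) * B) i p.2).rank = n) :
    ∃ (P : Matrix (Fin n) (Fin n) ℝ) (L : Matrix (Fin m) (Fin n) ℝ),
      Pᵀ = P ∧ (∀ a, a ⬝ᵥ a ≤ a ⬝ᵥ (P *ᵥ a)) ∧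
      ∀ a b, 0 ≤ a ⬝ᵥ (P *ᵥ a) - a ⬝ᵥ a + 2 * (a ⬝ᵥ ((A * P + B * L) *ᵥ b))
        + b ⬝ᵥ (P *ᵥ b) := by
  obtain ⟨R, hR⟩ := aux_rank_right_inv (Matrix.of fun (i : Fin n) (p : Fin n × Fin m) =>
        (A ^ (p.1 : ℕ) * B) i p.2) (by simpa using hctrb)
  let V : ℕ → Matrix (Fin m) (Fin n) ℝ := fun k =>
    if h : k < n then Matrix.of fun q j => -(R * A ^ n) (⟨n - 1 - k, by omega⟩, q) j else 0
  let X : ℕ → Matrix (Fin n) (Fin n) ℝ := fun k =>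
    Nat.rec 1 (fun k Xk => A * Xk + B * V k) k
  have hX0 : X 0 = 1 := rfl
  have hXs : ∀ k, X (k + 1) = A * X k + B * V k := fun k => rfl
  have hXk : ∀ k, X k = A ^ k + ∑ i ∈ Finset.range k, A ^ (k - 1 - i) * B * V i := by
    intro k
    induction k with
    | zero => simp [hX0]
    | succ k ih =>
      rw [hXs, ih, Finset.sum_range_succ, mul_add, Finset.mul_sum, pow_succ']
      have : ∑ i ∈ Finset.range k, A * (A ^ (k - 1 - i) * B * V i)
          = ∑ i ∈ Finset.range k, A ^ (k + 1 - 1 - i) * B * V i := by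
        refine Finset.sum_congr rfl fun i hi => ?_
        have hi' := Finset.mem_range.mp hi
        rw [show k + 1 - 1 - i = (k - 1 - i) + 1 by omega, pow_succ']
        simp only [Matrix.mul_assoc]
      rw [this]
      simp [add_assoc]
  have hXn : X n = 0 := by
    rw [hXk]
    have h1 : A ^ n = (Matrix.of fun (i : Fin n) (p : Fin n × Fin m) =>
        (A ^ (p.1 : ℕ) * B) i p.2) * (R * A ^ n) := by
      rw [← Matrix.mul_assoc, hR, Matrix.one_mul]
    have h2 : ∑ i ∈ Finset.range n, A ^ (n - 1 - i) * B * V i = - A ^ n := by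
      rw [h1, ← Finset.sum_range_reflect, ← Fin.sum_univ_eq_sum_range
        (fun j => A ^ (n - 1 - (n - 1 - j)) * B * V (n - 1 - j))]
      ext i j
      rw [Matrix.sum_apply, Matrix.neg_apply, Matrix.mul_apply, Fintype.sum_prod_type,
        ← Finset.sum_neg_distrib]
      refine Finset.sum_congr rfl fun k _ => ?_
      have hk := k.2
      rw [Matrix.mul_apply, ← Finset.sum_neg_distrib]
      refine Finset.sum_congr rfl fun q _ => ?_
      have e1 : n - 1 - (n - 1 - (k : ℕ)) = k := by omega
      have e2 : n - 1 - (k : ℕ) < n := by omega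
      simp only [V, e2, e1, dif_pos, Matrix.of_apply, Fin.eta]
      ring
    rw [h2, add_neg_cancel]
  refine ⟨∑ k ∈ Finset.range n, X k * (X k)ᵀ, ∑ k ∈ Finset.range n, V k * (X k)ᵀ, ?_, ?_⟩
  · rw [Matrix.transpose_sum]
    simp
  have hP : ∀ a : Fin n → ℝ, a ⬝ᵥ ((∑ k ∈ Finset.range n, X k * (X k)ᵀ) *ᵥ a) =
      ∑ k ∈ Finset.range n, ((X k)ᵀ *ᵥ a) ⬝ᵥ ((X k)ᵀ *ᵥ a) := by
    intro a
    rw [Matrix.sum_mulVec, dotProduct_sum]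
    exact Finset.sum_congr rfl fun k _ => aux_gram _ _
  have hshift : ∀ a : Fin n → ℝ, (∑ k ∈ Finset.range n, ((X k)ᵀ *ᵥ a) ⬝ᵥ ((X k)ᵀ *ᵥ a)) =
      a ⬝ᵥ a + ∑ k ∈ Finset.range n, ((X (k + 1))ᵀ *ᵥ a) ⬝ᵥ ((X (k + 1))ᵀ *ᵥ a) := by
    intro a
    have := Finset.sum_range_succ (fun k => ((X k)ᵀ *ᵥ a) ⬝ᵥ ((X k)ᵀ *ᵥ a)) n
    rw [Finset.sum_range_succ'] at this
    simp only [hXn, hX0, Matrix.transpose_zero, Matrix.zero_mulVec, zero_dotProduct, add_zero,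
      Matrix.transpose_one, Matrix.one_mulVec] at this
    linarith
  have hnn : ∀ {q : ℕ} (w : Fin q → ℝ), 0 ≤ w ⬝ᵥ w := fun w =>
    Finset.sum_nonneg fun i _ => mul_self_nonneg _
  constructor
  · intro a
    rw [hP, hshift]
    have : 0 ≤ ∑ k ∈ Finset.range n, ((X (k + 1))ᵀ *ᵥ a) ⬝ᵥ ((X (k + 1))ᵀ *ᵥ a) :=
      Finset.sum_nonneg fun k _ => hnn _
    linarith
  · intro a b
    have hY : A * (∑ k ∈ Finset.range n, X k * (X k)ᵀ) + B * (∑ k ∈ Finset.range n, V k * (X k)ᵀ)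
        = ∑ k ∈ Finset.range n, X (k + 1) * (X k)ᵀ := by
      rw [Matrix.mul_sum, Matrix.mul_sum, ← Finset.sum_add_distrib]
      refine Finset.sum_congr rfl fun k _ => ?_
      rw [hXs, Matrix.add_mul, Matrix.mul_assoc, Matrix.mul_assoc]
    rw [hY, hP, hP, hshift a, Matrix.sum_mulVec, dotProduct_sum]
    have : a ⬝ᵥ a + (∑ k ∈ Finset.range n, ((X (k + 1))ᵀ *ᵥ a) ⬝ᵥ ((X (k + 1))ᵀ *ᵥ a)) - a ⬝ᵥ a
        + 2 * (∑ k ∈ Finset.range n, a ⬝ᵥ ((X (k + 1) * (X k)ᵀ) *ᵥ b))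
        + ∑ k ∈ Finset.range n, ((X k)ᵀ *ᵥ b) ⬝ᵥ ((X k)ᵀ *ᵥ b)
        = ∑ k ∈ Finset.range n, ((X (k + 1))ᵀ *ᵥ a + (X k)ᵀ *ᵥ b) ⬝ᵥ
          ((X (k + 1))ᵀ *ᵥ a + (X k)ᵀ *ᵥ b) := by
      rw [Finset.mul_sum, add_sub_cancel_left, ← Finset.sum_add_distrib, ← Finset.sum_add_distrib]
      refine Finset.sum_congr rfl fun k _ => ?_
      rw [← Matrix.mulVec_mulVec, aux_adj (X (k + 1)) a]
      simp only [add_dotProduct, dotProduct_add]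
      rw [dotProduct_comm ((X k)ᵀ *ᵥ b) ((X (k + 1))ᵀ *ᵥ a)]
      ring
    rw [this]
    exact Finset.sum_nonneg fun k _ => hnn _


/-- Willems fundamental lemma (left-kernel form). -/
lemma aux_willems {n m T : ℕ} (A : Matrix (Fin n) (Fin n) ℝ) (B : Matrix (Fin n) (Fin m) ℝ)
    (hctrb : (Matrix.of fun (i : Fin n) (p : Fin n × Fin m) =>
        (A ^ (p.1 : ℕ) * B) i p.2).rank = n)
    (u : ℕ → Fin m → ℝ)
    (hPE : (Matrix.of fun (p : Fin (n + 1) × Fin m) (j : Fin (T - n)) =>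
        u ((p.1 : ℕ) + (j : ℕ)) p.2).rank = m * (n + 1))
    (x : ℕ → Fin n → ℝ) (hx : ∀ k, x (k + 1) = A *ᵥ x k + B *ᵥ u k)
    (ξ : Fin n → ℝ) (η : Fin m → ℝ) (h : ∀ k < T, ξ ⬝ᵥ x k + η ⬝ᵥ u k = 0) :
    ξ = 0 ∧ η = 0 := by
  let c : ℕ → ℝ := fun j => A.charpoly.coeff j
  let β : ℕ → Fin m → ℝ := fun r => (A ^ r * B)ᵀ *ᵥ ξ
  have hcn : c n = 1 := by
    have h1 := A.charpoly_monic.coeff_natDegree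
    rw [A.charpoly_natDegree_eq_dim, Fintype.card_fin] at h1
    exact h1
  have hCH : ∑ j ∈ Finset.range (n + 1), c j • A ^ j = 0 := by
    have h1 := A.aeval_self_charpoly
    rw [Polynomial.aeval_eq_sum_range, A.charpoly_natDegree_eq_dim, Fintype.card_fin] at h1
    exact h1
  have hexp : ∀ k j, x (k + j) = A ^ j *ᵥ x k +
      ∑ i ∈ Finset.range j, (A ^ (j - 1 - i) * B) *ᵥ u (k + i) := by
    intro k j
    induction j with
    | zero => simp
    | succ j ih =>
      rw [← add_assoc, hx, ih, Finset.sum_range_succ, Matrix.mulVec_add, Matrix.mulVec_sum,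
        Matrix.mulVec_mulVec, ← pow_succ']
      have : ∑ i ∈ Finset.range j, A *ᵥ ((A ^ (j - 1 - i) * B) *ᵥ u (k + i))
          = ∑ i ∈ Finset.range j, (A ^ (j + 1 - 1 - i) * B) *ᵥ u (k + i) := by
        refine Finset.sum_congr rfl fun i hi => ?_
        have hi' := Finset.mem_range.mp hi
        rw [show j + 1 - 1 - i = (j - 1 - i) + 1 by omega, pow_succ', Matrix.mulVec_mulVec,
          Matrix.mul_assoc]
      rw [this]
      simp [add_assoc]
  have hexp2 : ∀ k, ∀ j ∈ Finset.range (n + 1), ξ ⬝ᵥ x (k + j) = ξ ⬝ᵥ (A ^ j *ᵥ x k) +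
      ∑ i ∈ Finset.range (n + 1), if i < j then β (j - 1 - i) ⬝ᵥ u (k + i) else 0 := by
    intro k j hj
    have hj' := Finset.mem_range.mp hj
    rw [hexp, dotProduct_add, dotProduct_sum, ← Finset.sum_filter]
    congr 1
    have : (Finset.range (n + 1)).filter (fun i => i < j) = Finset.range j := by
      ext i; simp; omega
    rw [this]
    exact Finset.sum_congr rfl fun i _ => aux_adj _ _ _
  let w : ℕ → Fin m → ℝ := fun i => c i • η +
    ∑ j ∈ Finset.range (n + 1), if i < j then c j • β (j - 1 - i) else 0
  have hw : ∀ k < T - n, ∑ i ∈ Finset.range (n + 1), w i ⬝ᵥ u (k + i) = 0 := by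
    intro k hk
    have e0 : ∑ j ∈ Finset.range (n + 1), c j * (ξ ⬝ᵥ x (k + j) + η ⬝ᵥ u (k + j)) = 0 := by
      refine Finset.sum_eq_zero fun j hj => ?_
      have hj' := Finset.mem_range.mp hj
      rw [h (k + j) (by omega), mul_zero]
    have e1 : ∑ j ∈ Finset.range (n + 1), c j * (ξ ⬝ᵥ (A ^ j *ᵥ x k)) = 0 := by
      have : ξ ⬝ᵥ ((∑ j ∈ Finset.range (n + 1), c j • A ^ j) *ᵥ x k) = 0 := by
        rw [hCH, Matrix.zero_mulVec, dotProduct_zero]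
      rw [Matrix.sum_mulVec, dotProduct_sum] at this
      simpa [Matrix.smul_mulVec] using this
    have e2 : ∑ i ∈ Finset.range (n + 1), w i ⬝ᵥ u (k + i) =
        ∑ j ∈ Finset.range (n + 1), (c j * (η ⬝ᵥ u (k + j)) + c j *
          ∑ i ∈ Finset.range (n + 1), if i < j then β (j - 1 - i) ⬝ᵥ u (k + i) else 0) := by
      simp only [w, add_dotProduct, smul_dotProduct, smul_eq_mul, sum_dotProduct,
        Finset.sum_add_distrib, Finset.mul_sum]
      congr 1
      rw [Finset.sum_comm]
      refine Finset.sum_congr rfl fun j _ => Finset.sum_congr rfl fun i _ => ?_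
      split_ifs <;> simp
    have e3 := sub_eq_zero.mpr (e0.trans e1.symm)
    rw [← Finset.sum_sub_distrib] at e3
    rw [e2]
    refine Eq.trans (Finset.sum_congr rfl fun j hj => ?_) e3
    rw [hexp2 k j hj]
    ring
  have hw0 : ∀ i < n + 1, w i = 0 := by
    obtain ⟨G, hG⟩ := aux_rank_right_inv (Matrix.of fun (p : Fin (n + 1) × Fin m) (j : Fin (T - n)) =>
        u ((p.1 : ℕ) + (j : ℕ)) p.2) (by rw [hPE]; simp [mul_comm])
    have := aux_right_inv_ker _ G hG (fun p => w p.1 p.2) (by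
      ext j
      have h1 := hw j j.2
      rw [← Fin.sum_univ_eq_sum_range (fun i => w i ⬝ᵥ u (j + i))] at h1
      simp only [Matrix.vecMul, dotProduct, Matrix.of_apply, Fintype.sum_prod_type, Pi.zero_apply]
      rw [← h1]
      refine Finset.sum_congr rfl fun i _ => ?_
      simp only [dotProduct, add_comm])
    intro i hi
    ext q
    exact congrFun this (⟨i, hi⟩, q)
  have hη : η = 0 := by
    have h1 := hw0 n (by omega)
    have h2 : ∑ j ∈ Finset.range (n + 1), (if n < j then c j • β (j - 1 - n) else 0) = 0 := by
      refine Finset.sum_eq_zero fun j hj => ?_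
      have hj' := Finset.mem_range.mp hj
      rw [if_neg (by omega)]
    simp only [w] at h1
    rw [h2, hcn] at h1
    simpa using h1
  have hβ : ∀ r, r < n → β r = 0 := by
    intro r
    induction r using Nat.strong_induction_on with
    | _ r ih =>
      intro hr
      have h1 := hw0 (n - 1 - r) (by omega)
      simp only [w] at h1
      rw [hη, smul_zero, zero_add, Finset.sum_range_succ, Finset.sum_eq_zero, zero_add,
        if_pos (by omega), hcn, one_smul, show n - 1 - (n - 1 - r) = r by omega] at h1
      · exact h1
      · intro j hj
        have hj' := Finset.mem_range.mp hj
        split_ifs with hlt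
        · rw [ih _ (by omega) (by omega), smul_zero]
        · rfl
  refine ⟨?_, hη⟩
  obtain ⟨G, hG⟩ := aux_rank_right_inv (Matrix.of fun (i : Fin n) (p : Fin n × Fin m) =>
        (A ^ (p.1 : ℕ) * B) i p.2) (by simpa using hctrb)
  refine aux_right_inv_ker _ G hG ξ ?_
  ext p
  have h1 := congrFun (hβ p.1 p.1.2) p.2
  simp only [β, Matrix.mulVec_transpose] at h1
  exact h1

/-- `(A,B)` controllable implies `[A B]` has full row rank (left-kernel form). -/
lemma aux_ctrb_ker {n m : ℕ} (A : Matrix (Fin n) (Fin n) ℝ) (B : Matrix (Fin n) (Fin m) ℝ)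
    (hctrb : (Matrix.of fun (i : Fin n) (p : Fin n × Fin m) =>
        (A ^ (p.1 : ℕ) * B) i p.2).rank = n) (ξ : Fin n → ℝ) (h1 : ξ ᵥ* A = 0) (h2 : ξ ᵥ* B = 0) :
    ξ = 0 := by
  obtain ⟨G, hG⟩ := aux_rank_right_inv (Matrix.of fun (i : Fin n) (p : Fin n × Fin m) =>
        (A ^ (p.1 : ℕ) * B) i p.2) (by simpa using hctrb)
  refine aux_right_inv_ker _ G hG ξ ?_
  ext p
  have h3 : ξ ᵥ* (A ^ (p.1 : ℕ) * B) = 0 := by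
    rcases Nat.eq_zero_or_pos (p.1 : ℕ) with h | h
    · rw [h, pow_zero, Matrix.one_mul, h2]
    · rw [show (p.1 : ℕ) = (p.1 - 1 : ℕ) + 1 by omega, pow_succ', Matrix.mul_assoc,
        ← Matrix.vecMul_vecMul, h1, Matrix.zero_vecMul]
  exact congrFun h3 p.2

/-- Dual Lyapunov inequality. -/
lemma aux_dual {n : ℕ} (P F : Matrix (Fin n) (Fin n) ℝ) (hP : P.PosDef)
    (h : ∀ a, a ≠ 0 → (Fᵀ *ᵥ a) ⬝ᵥ (P *ᵥ (Fᵀ *ᵥ a)) < a ⬝ᵥ (P *ᵥ a)) :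
    (P⁻¹).PosDef ∧ (P⁻¹ - Fᵀ * P⁻¹ * F).PosDef := by
  have hS : (P⁻¹).PosDef := hP.inv
  have hST : (P⁻¹)ᵀ = P⁻¹ := by simpa using hS.isHermitian.eq
  have hPT : Pᵀ = P := by simpa using hP.isHermitian.eq
  have hu : IsUnit P.det := (Matrix.isUnit_iff_isUnit_det P).mp hP.isUnit
  refine ⟨hS, Matrix.PosDef.of_dotProduct_mulVec_pos ?_ ?_⟩
  · rw [Matrix.IsHermitian, Matrix.conjTranspose_eq_transpose_of_trivial]
    simp [Matrix.transpose_mul, hST, Matrix.mul_assoc]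
  intro x hx
  rw [star_trivial, Matrix.sub_mulVec, dotProduct_sub]
  set y := F *ᵥ x with hy
  set a := P⁻¹ *ᵥ y with ha
  have hxS : 0 < x ⬝ᵥ (P⁻¹ *ᵥ x) := by simpa using hS.dotProduct_mulVec_pos hx
  have hPa : P *ᵥ a = y := by
    rw [ha, Matrix.mulVec_mulVec, Matrix.mul_nonsing_inv _ hu, Matrix.one_mulVec]
  have e1 : x ⬝ᵥ ((Fᵀ * P⁻¹ * F) *ᵥ x) = a ⬝ᵥ y := by
    rw [← Matrix.mulVec_mulVec, ← Matrix.mulVec_mulVec, aux_adj, Matrix.transpose_transpose,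
      ← hy, dotProduct_comm]
  rw [e1]
  by_cases ha0 : a = 0
  · simpa [ha0] using hxS
  have h1 := h a ha0
  rw [hPa] at h1
  set v := Fᵀ *ᵥ a with hv
  have h2 := hP.posSemidef.dotProduct_mulVec_nonneg (v - P⁻¹ *ᵥ x)
  have hPx : P *ᵥ (P⁻¹ *ᵥ x) = x := by
    rw [Matrix.mulVec_mulVec, Matrix.mul_nonsing_inv _ hu, Matrix.one_mulVec]
  rw [star_trivial, Matrix.mulVec_sub, hPx,
    sub_dotProduct, dotProduct_sub, dotProduct_sub, aux_adj P (P⁻¹ *ᵥ x) v, hPT, hPx,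
    dotProduct_comm x v, dotProduct_comm (P⁻¹ *ᵥ x) x] at h2
  have e2 : v ⬝ᵥ x = a ⬝ᵥ y := by rw [hv, ← aux_adj]
  rw [e2] at h2
  linarith

/-- Lyapunov indirect method in discrete time. -/
lemma aux_stab {n : ℕ} (g : (Fin n → ℝ) → (Fin n → ℝ)) (F S : Matrix (Fin n) (Fin n) ℝ)
    (hg : (fun x => g x - F *ᵥ x) =o[𝓝 0] (fun x => x))
    (hS : S.PosDef) (hSF : (S - Fᵀ * S * F).PosDef) :
    ∃ δ > (0 : ℝ), ∃ c > (0 : ℝ), ∃ ρ ∈ Set.Ioo (0 : ℝ) 1,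
      ∀ z : ℕ → Fin n → ℝ, (∀ k, z (k + 1) = g (z k)) →
        ‖z 0‖ ≤ δ → ∀ k, ‖z k‖ ≤ c * ρ ^ k * ‖z 0‖ := by
  have hST : Sᵀ = S := by simpa using hS.isHermitian.eq
  obtain ⟨r, hrPD, hr0, hr1⟩ : ∃ r : ℝ, (r • S - Fᵀ * S * F).PosDef ∧ 0 < r ∧ r < 1 := by
    have hc : Tendsto (fun r : ℝ => r • S - Fᵀ * S * F) (𝓝 1) (𝓝 (S - Fᵀ * S * F)) := by
      have : Continuous (fun r : ℝ => r • S - Fᵀ * S * F) := by fun_prop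
      simpa using this.tendsto 1
    have h1 := hc.eventually (aux_posDef_open _ hSF)
    have h2 : ∀ᶠ r : ℝ in 𝓝[<] 1, (r ∈ Set.Ioo (0 : ℝ) 1) := Ioo_mem_nhdsLT one_pos
    obtain ⟨r, hr, hr'⟩ := ((h1.filter_mono nhdsWithin_le_nhds).and h2).exists
    refine ⟨r, hr ?_, hr'⟩
    rw [Matrix.IsHermitian, Matrix.conjTranspose_eq_transpose_of_trivial]
    simp [Matrix.transpose_mul, hST, Matrix.mul_assoc]
  obtain ⟨c0, hc0, hcoer⟩ := aux_posDef_coercive _ hrPD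
  obtain ⟨l, hl, hlow⟩ := aux_posDef_coercive _ hS
  obtain ⟨C, hC, hup⟩ := aux_bilin_bound S
  obtain ⟨L, hL, hFL⟩ : ∃ L > 0, ∀ x, ‖F *ᵥ x‖ ≤ L * ‖x‖ := by
    let Fc := LinearMap.toContinuousLinearMap F.mulVecLin
    refine ⟨‖Fc‖ + 1, by positivity, fun x => ?_⟩
    have h1 := Fc.le_opNorm x
    have h2 : Fc x = F *ᵥ x := rfl
    rw [h2] at h1
    nlinarith [norm_nonneg x]
  obtain ⟨τ, hτ0, hτ1, hτ2⟩ : ∃ τ : ℝ, 0 < τ ∧ τ ≤ 1 ∧ C * τ * (2 * L + 1) ≤ c0 := by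
    refine ⟨min 1 (c0 / (C * (2 * L + 1))), by positivity, min_le_left _ _, ?_⟩
    have h1 : min 1 (c0 / (C * (2 * L + 1))) ≤ c0 / (C * (2 * L + 1)) := min_le_right _ _
    rw [le_div_iff₀ (by positivity)] at h1
    linarith
  have hev := hg.def hτ0
  obtain ⟨δ1, hδ1, hball⟩ := Metric.eventually_nhds_iff_ball.mp hev
  have hdec : ∀ x : Fin n → ℝ, ‖x‖ < δ1 → g x ⬝ᵥ (S *ᵥ g x) ≤ r * (x ⬝ᵥ (S *ᵥ x)) := by
    intro x hx
    have he := hball x (by simpa using hx)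
    set e := g x - F *ᵥ x with hedef
    have hgx : g x = F *ᵥ x + e := by rw [hedef]; abel
    have h1 := hcoer x
    have h2 := hFL x
    have h3 : x ⬝ᵥ ((r • S - Fᵀ * S * F) *ᵥ x) =
        r * (x ⬝ᵥ (S *ᵥ x)) - (F *ᵥ x) ⬝ᵥ (S *ᵥ (F *ᵥ x)) := by
      rw [Matrix.sub_mulVec, dotProduct_sub, Matrix.smul_mulVec, dotProduct_smul, smul_eq_mul,
        ← Matrix.mulVec_mulVec, ← Matrix.mulVec_mulVec, aux_adj Fᵀ, Matrix.transpose_transpose]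
    have b1 := (le_abs_self _).trans (hup (F *ᵥ x) e)
    have b2 := (le_abs_self _).trans (hup e (F *ᵥ x))
    have b3 := (le_abs_self _).trans (hup e e)
    have h4 : C * ‖F *ᵥ x‖ * ‖e‖ ≤ C * (L * ‖x‖) * (τ * ‖x‖) := by gcongr
    have h5 : C * ‖e‖ * ‖e‖ ≤ C * (τ * ‖x‖) * (1 * ‖x‖) := by
      gcongr
      exact he.trans (by gcongr)
    have h6 : C * τ * (2 * L + 1) * ‖x‖ ^ 2 ≤ c0 * ‖x‖ ^ 2 := by gcongr
    rw [hgx, Matrix.mulVec_add, add_dotProduct, dotProduct_add, dotProduct_add]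
    rw [h3] at h1
    nlinarith
  set c := Real.sqrt (C / l) + 1 with hcdef
  have hcpos : 0 < c := by positivity
  have hc2 : C / l ≤ c ^ 2 := by
    have h1 := Real.sq_sqrt (show 0 ≤ C / l by positivity)
    have h2 := Real.sqrt_nonneg (C / l)
    nlinarith
  have hρ2 := Real.sq_sqrt hr0.le
  have hρ0 : 0 < Real.sqrt r := Real.sqrt_pos.mpr hr0
  have hρ1 : Real.sqrt r < 1 := by nlinarith
  refine ⟨δ1 / (2 * c), by positivity, c, hcpos, Real.sqrt r, ⟨hρ0, hρ1⟩, ?_⟩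
  intro z hz hz0
  have hnorm : ∀ k, z k ⬝ᵥ (S *ᵥ z k) ≤ r ^ k * (z 0 ⬝ᵥ (S *ᵥ z 0)) →
      ‖z k‖ ≤ c * Real.sqrt r ^ k * ‖z 0‖ := by
    intro k hk
    have h1 := hlow (z k)
    have h2 := (le_abs_self _).trans (hup (z 0) (z 0))
    have h3 : l * ‖z k‖ ^ 2 ≤ r ^ k * (C * ‖z 0‖ * ‖z 0‖) :=
      h1.trans (hk.trans (by gcongr))
    refine le_of_sq_le_sq ?_ (by positivity)
    have h4 : (c * Real.sqrt r ^ k * ‖z 0‖) ^ 2 = c ^ 2 * (r ^ k * ‖z 0‖ ^ 2) := by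
      rw [mul_pow, mul_pow, ← pow_mul, mul_comm k 2, pow_mul, hρ2]; ring
    rw [h4]
    have h5 : C / l * (r ^ k * ‖z 0‖ ^ 2) ≤ c ^ 2 * (r ^ k * ‖z 0‖ ^ 2) := by gcongr
    refine le_trans ?_ h5
    rw [div_mul_eq_mul_div, le_div_iff₀ hl]
    nlinarith
  have hV : ∀ k, z k ⬝ᵥ (S *ᵥ z k) ≤ r ^ k * (z 0 ⬝ᵥ (S *ᵥ z 0)) := by
    intro k
    induction k with
    | zero => simp
    | succ k ih =>
      have h1 := hnorm k ih
      have h2 : c * Real.sqrt r ^ k * ‖z 0‖ ≤ c * 1 * (δ1 / (2 * c)) := by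
        gcongr
        exact pow_le_one₀ hρ0.le hρ1.le
      have h3 : c * 1 * (δ1 / (2 * c)) < δ1 := by
        have : c * 1 * (δ1 / (2 * c)) = δ1 / 2 := by field_simp
        rw [this]; linarith
      have h4 := hdec (z k) (by linarith)
      rw [hz]
      calc _ ≤ _ := h4
        _ ≤ r * (r ^ k * (z 0 ⬝ᵥ (S *ᵥ z 0))) := by gcongr
        _ = _ := by ring
  exact fun k => hnorm k (hV k)

/-- The data LMIs. -/
def AuxFeas {n T : ℕ} (X0 X1 : Matrix (Fin n) (Fin T) ℝ) (Q : Matrix (Fin T) (Fin n) ℝ) (α : ℝ) :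
    Prop :=
  (fromBlocks (X0 * Q - α • (X1 * X1ᵀ)) (X1 * Q) (Qᵀ * X1ᵀ) (X0 * Q)).PosSemidef ∧
    (fromBlocks (1 : Matrix (Fin T) (Fin T) ℝ) Q Qᵀ (X0 * Q)).PosSemidef

lemma aux_block_form1 {n T : ℕ} (P : Matrix (Fin n) (Fin n) ℝ) (X1 : Matrix (Fin n) (Fin T) ℝ)
    (Q : Matrix (Fin T) (Fin n) ℝ) (α : ℝ) (a b : Fin n → ℝ) :
    Sum.elim a b ⬝ᵥ (fromBlocks (P - α • (X1 * X1ᵀ)) (X1 * Q) (Qᵀ * X1ᵀ) P *ᵥ Sum.elim a b) =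
      a ⬝ᵥ (P *ᵥ a) - α * ((X1ᵀ *ᵥ a) ⬝ᵥ (X1ᵀ *ᵥ a)) + 2 * (a ⬝ᵥ ((X1 * Q) *ᵥ b))
        + b ⬝ᵥ (P *ᵥ b) := by
  rw [aux_block_form, Matrix.sub_mulVec, dotProduct_sub, Matrix.smul_mulVec, dotProduct_smul,
    aux_gram, smul_eq_mul, ← Matrix.transpose_mul, aux_adj (X1 * Q)ᵀ, Matrix.transpose_transpose,
    dotProduct_comm ((X1 * Q) *ᵥ b) a]
  ring

lemma aux_block_form2 {n T : ℕ} (P : Matrix (Fin n) (Fin n) ℝ)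
    (Q : Matrix (Fin T) (Fin n) ℝ) (w : Fin T → ℝ) (b : Fin n → ℝ) :
    Sum.elim w b ⬝ᵥ (fromBlocks (1 : Matrix (Fin T) (Fin T) ℝ) Q Qᵀ P *ᵥ Sum.elim w b) =
      w ⬝ᵥ w + 2 * (w ⬝ᵥ (Q *ᵥ b)) + b ⬝ᵥ (P *ᵥ b) := by
  rw [aux_block_form, Matrix.one_mulVec, aux_adj Qᵀ, Matrix.transpose_transpose,
    dotProduct_comm (Q *ᵥ b) w]
  ring

lemma aux_herm1 {n T : ℕ} (P : Matrix (Fin n) (Fin n) ℝ) (X1 : Matrix (Fin n) (Fin T) ℝ)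
    (Q : Matrix (Fin T) (Fin n) ℝ) (α : ℝ) (hP : Pᵀ = P) :
    (fromBlocks (P - α • (X1 * X1ᵀ)) (X1 * Q) (Qᵀ * X1ᵀ) P).IsHermitian := by
  rw [Matrix.IsHermitian, Matrix.conjTranspose_eq_transpose_of_trivial, fromBlocks_transpose]
  simp [Matrix.transpose_mul, hP]

lemma aux_herm2 {n T : ℕ} (P : Matrix (Fin n) (Fin n) ℝ)
    (Q : Matrix (Fin T) (Fin n) ℝ) (hP : Pᵀ = P) :
    (fromBlocks (1 : Matrix (Fin T) (Fin T) ℝ) Q Qᵀ P).IsHermitian := by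
  rw [Matrix.IsHermitian, Matrix.conjTranspose_eq_transpose_of_trivial, fromBlocks_transpose]
  simp [hP]

lemma aux_feas_iff {n T : ℕ} (X0 X1 : Matrix (Fin n) (Fin T) ℝ) (Q : Matrix (Fin T) (Fin n) ℝ)
    (α : ℝ) : AuxFeas X0 X1 Q α ↔ (X0 * Q)ᵀ = X0 * Q ∧
      (∀ a b, 0 ≤ a ⬝ᵥ ((X0 * Q) *ᵥ a) - α * ((X1ᵀ *ᵥ a) ⬝ᵥ (X1ᵀ *ᵥ a))
        + 2 * (a ⬝ᵥ ((X1 * Q) *ᵥ b)) + b ⬝ᵥ ((X0 * Q) *ᵥ b)) ∧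
      (∀ w b, 0 ≤ w ⬝ᵥ w + 2 * (w ⬝ᵥ (Q *ᵥ b)) + b ⬝ᵥ ((X0 * Q) *ᵥ b)) := by
  constructor
  · rintro ⟨h1, h2⟩
    refine ⟨?_, fun a b => ?_, fun w b => ?_⟩
    · have := h2.isHermitian
      rw [Matrix.IsHermitian, Matrix.conjTranspose_eq_transpose_of_trivial, fromBlocks_transpose,
        fromBlocks_inj] at this
      exact this.2.2.2
    · have := h1.dotProduct_mulVec_nonneg (Sum.elim a b)
      rwa [star_trivial, aux_block_form1] at this
    · have := h2.dotProduct_mulVec_nonneg (Sum.elim w b)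
      rwa [star_trivial, aux_block_form2] at this
  · rintro ⟨hT, h1, h2⟩
    refine ⟨.of_dotProduct_mulVec_nonneg (aux_herm1 _ _ _ _ hT) fun x => ?_,
      .of_dotProduct_mulVec_nonneg (aux_herm2 _ _ hT) fun x => ?_⟩
    · rw [star_trivial, ← Sum.elim_comp_inl_inr x, aux_block_form1]
      exact h1 _ _
    · rw [star_trivial, ← Sum.elim_comp_inl_inr x, aux_block_form2]
      exact h2 _ _

lemma aux_feas_scale {n T : ℕ} (X0 X1 : Matrix (Fin n) (Fin T) ℝ) (Q : Matrix (Fin T) (Fin n) ℝ)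
    (α s : ℝ) (h : AuxFeas X0 X1 Q α) : AuxFeas (s • X0) (s • X1) (s • Q) α := by
  rw [aux_feas_iff] at h ⊢
  obtain ⟨hT, h1, h2⟩ := h
  refine ⟨?_, fun a b => ?_, fun w b => ?_⟩
  · simp [hT]
  · have := h1 (s • a) (s • b)
    simp only [Matrix.smul_mul, Matrix.mul_smul, Matrix.smul_mulVec, Matrix.mulVec_smul,
      Matrix.transpose_smul, dotProduct_smul, smul_dotProduct, smul_eq_mul] at this ⊢
    linarith
  · have := h2 w (s • b)
    simp only [Matrix.smul_mul, Matrix.mul_smul, Matrix.smul_mulVec, Matrix.mulVec_smul,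
      dotProduct_smul, smul_dotProduct, smul_eq_mul] at this ⊢
    linarith

lemma aux_exists_pos_posDef {n : ℕ} (M N : Matrix (Fin n) (Fin n) ℝ) (hM : M.PosDef)
    (hN : Nᵀ = N) : ∃ t : ℝ, 0 < t ∧ t < 1 ∧ (M - t • N).PosDef := by
  have hMT : Mᵀ = M := by simpa using hM.isHermitian.eq
  have hc : Tendsto (fun t : ℝ => M - t • N) (𝓝 0) (𝓝 M) := by
    have : Continuous (fun t : ℝ => M - t • N) := by fun_prop
    simpa using this.tendsto 0
  have h1 := hc.eventually (aux_posDef_open _ hM)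
  have h2 : ∀ᶠ r : ℝ in 𝓝[>] 0, (r ∈ Set.Ioo (0 : ℝ) 1) := Ioo_mem_nhdsGT one_pos
  obtain ⟨r, hr, hr'⟩ := ((h1.filter_mono nhdsWithin_le_nhds).and h2).exists
  refine ⟨r, hr'.1, hr'.2, hr ?_⟩
  rw [Matrix.IsHermitian, Matrix.conjTranspose_eq_transpose_of_trivial]
  simp [hMT, hN]

lemma aux_dot_nonneg {q : ℕ} (w : Fin q → ℝ) : 0 ≤ w ⬝ᵥ w :=
    Finset.sum_nonneg fun _ _ => mul_self_nonneg _

lemma aux_dot_pos {q : ℕ} (w : Fin q → ℝ) (hw : w ≠ 0) : 0 < w ⬝ᵥ w :=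
  lt_of_le_of_ne (aux_dot_nonneg w) fun h => hw (dotProduct_self_eq_zero.mp h.symm)

/-- Strict feasibility of the LMIs for the linearized data. -/
lemma aux_strict {n m T : ℕ} (A : Matrix (Fin n) (Fin n) ℝ) (B : Matrix (Fin n) (Fin m) ℝ)
    (hctrb : (Matrix.of fun (i : Fin n) (p : Fin n × Fin m) =>
        (A ^ (p.1 : ℕ) * B) i p.2).rank = n)
    (U0 : Matrix (Fin m) (Fin T) ℝ) (X0 X1 : Matrix (Fin n) (Fin T) ℝ)
    (hX1 : X1 = A * X0 + B * U0)
    (G : Matrix (Fin T) (Fin m ⊕ Fin n) ℝ) (hG : fromRows U0 X0 * G = 1) :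
    ∃ (Q : Matrix (Fin T) (Fin n) ℝ) (α : ℝ), 0 < α ∧ (X0 * Q).PosDef ∧
      (fromBlocks (X0 * Q - α • (X1 * X1ᵀ)) (X1 * Q) (Qᵀ * X1ᵀ) (X0 * Q)).PosDef ∧
      (fromBlocks (1 : Matrix (Fin T) (Fin T) ℝ) Q Qᵀ (X0 * Q)).PosDef := by
  obtain ⟨P, L, hPT, hP1, hlmi⟩ := aux_lyap A B hctrb
  set Q := G * fromRows L P with hQ
  have h0 : fromRows (U0 * Q) (X0 * Q) = fromRows L P := by
    rw [← fromRows_mul, hQ, ← Matrix.mul_assoc, hG, Matrix.one_mul]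
  obtain ⟨hUQ, hXQ⟩ := fromRows_inj.eq_iff.mp h0
  have hX1Q : X1 * Q = A * P + B * L := by
    rw [hX1, Matrix.add_mul, Matrix.mul_assoc, Matrix.mul_assoc, hXQ, hUQ]
  have hPpos : P.PosDef := by
    refine .of_dotProduct_mulVec_pos ?_ fun x hx => ?_
    · rw [Matrix.IsHermitian, Matrix.conjTranspose_eq_transpose_of_trivial, hPT]
    · rw [star_trivial]
      exact (aux_dot_pos x hx).trans_le (hP1 x)
  obtain ⟨α, hα, -, hαPD⟩ := aux_exists_pos_posDef 1 (X1 * X1ᵀ) Matrix.PosDef.one (by simp)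
  obtain ⟨t, ht, -, htPD⟩ := aux_exists_pos_posDef P (Qᵀ * Q) hPpos (by simp)
  have hXtQ : X0 * (t • Q) = t • P := by rw [Matrix.mul_smul, hXQ]
  have htT : (t • P)ᵀ = t • P := by rw [Matrix.transpose_smul, hPT]
  refine ⟨t • Q, t * α, by positivity, ?_, ?_, ?_⟩
  · rw [hXtQ]; exact hPpos.smul ht
  · rw [hXtQ]
    refine .of_dotProduct_mulVec_pos (aux_herm1 _ _ _ _ htT) fun x hx => ?_
    rw [star_trivial, ← Sum.elim_comp_inl_inr x, aux_block_form1, Matrix.mul_smul, hX1Q]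
    simp only [Matrix.smul_mulVec, dotProduct_smul, smul_eq_mul]
    set a := x ∘ Sum.inl
    set b := x ∘ Sum.inr
    have h1 := hlmi a b
    suffices 0 < a ⬝ᵥ (P *ᵥ a) - α * ((X1ᵀ *ᵥ a) ⬝ᵥ (X1ᵀ *ᵥ a))
        + 2 * (a ⬝ᵥ ((A * P + B * L) *ᵥ b)) + b ⬝ᵥ (P *ᵥ b) by
      have := mul_pos ht this
      linarith
    by_cases ha : a = 0
    · have hb : b ≠ 0 := by
        intro hb
        apply hx
        rw [← Sum.elim_comp_inl_inr x]
        change Sum.elim a b = 0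
        rw [ha, hb]; ext i; cases i <;> rfl
      have := hPpos.dotProduct_mulVec_pos hb
      rw [star_trivial] at this
      simpa [ha] using this
    · have := hαPD.dotProduct_mulVec_pos ha
      rw [star_trivial, Matrix.sub_mulVec, dotProduct_sub, Matrix.smul_mulVec, dotProduct_smul,
        aux_gram, smul_eq_mul, Matrix.one_mulVec] at this
      linarith
  · rw [hXtQ]
    refine .of_dotProduct_mulVec_pos (aux_herm2 _ _ htT) fun x hx => ?_
    rw [star_trivial, ← Sum.elim_comp_inl_inr x, aux_block_form2]
    simp only [Matrix.smul_mulVec, dotProduct_smul, smul_eq_mul]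
    set w := x ∘ Sum.inl
    set b := x ∘ Sum.inr
    have hsq : (w + t • (Q *ᵥ b)) ⬝ᵥ (w + t • (Q *ᵥ b)) =
        w ⬝ᵥ w + 2 * (t * (w ⬝ᵥ (Q *ᵥ b))) + t * (t * ((Q *ᵥ b) ⬝ᵥ (Q *ᵥ b))) := by
      simp only [add_dotProduct, dotProduct_add, dotProduct_smul, smul_dotProduct, smul_eq_mul]
      rw [dotProduct_comm (Q *ᵥ b) w]
      ring
    by_cases hb : b = 0
    · have hw : w ≠ 0 := by
        intro hw
        apply hx
        rw [← Sum.elim_comp_inl_inr x]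
        change Sum.elim w b = 0
        rw [hw, hb]; ext i; cases i <;> rfl
      simpa [hb] using aux_dot_pos w hw
    · have h1 := hPpos.dotProduct_mulVec_pos hb
      have h2 := htPD.dotProduct_mulVec_pos hb
      have h3 := aux_gram Qᵀ b
      rw [Matrix.transpose_transpose] at h3
      rw [star_trivial, Matrix.sub_mulVec, dotProduct_sub, Matrix.smul_mulVec, dotProduct_smul,
        h3, smul_eq_mul] at h2
      have h4 := aux_dot_nonneg (w + t • (Q *ᵥ b))
      have h5 := mul_pos ht h2
      nlinarith

/-- Feasibility with a uniform `α` persists under perturbation of the data. -/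
lemma aux_perturb {n T : ℕ} {l : Filter ℝ} (X0 X1 : Matrix (Fin n) (Fin T) ℝ)
    (Y0 Y1 : ℝ → Matrix (Fin n) (Fin T) ℝ) (h0 : Tendsto Y0 l (𝓝 X0)) (h1 : Tendsto Y1 l (𝓝 X1))
    (Q : Matrix (Fin T) (Fin n) ℝ) (α : ℝ) (hP : (X0 * Q).PosDef)
    (hb1 : (fromBlocks (X0 * Q - α • (X1 * X1ᵀ)) (X1 * Q) (Qᵀ * X1ᵀ) (X0 * Q)).PosDef)
    (hb2 : (fromBlocks (1 : Matrix (Fin T) (Fin T) ℝ) Q Qᵀ (X0 * Q)).PosDef) :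
    ∀ᶠ ε in l, ∃ Q', AuxFeas (Y0 ε) (Y1 ε) Q' α := by
  set P := X0 * Q with hPdef
  have hPT : Pᵀ = P := by simpa using hP.isHermitian.eq
  have hu : IsUnit P.det := (Matrix.isUnit_iff_isUnit_det P).mp hP.isUnit
  have hN : Tendsto (fun ε => Y0 ε * Q) l (𝓝 P) := by
    have : Continuous fun Y : Matrix (Fin n) (Fin T) ℝ => Y * Q := by fun_prop
    exact (this.tendsto X0).comp h0
  have hdet : ∀ᶠ ε in l, (Y0 ε * Q).det ≠ 0 := by
    have : Continuous fun Y : Matrix (Fin n) (Fin n) ℝ => Y.det := by fun_prop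
    exact ((this.tendsto P).comp hN).eventually_ne hu.ne_zero
  have hinv : Tendsto (fun ε => (Y0 ε * Q)⁻¹) l (𝓝 P⁻¹) := by
    simp only [Matrix.inv_def, Ring.inverse_eq_inv']
    have hc1 : Continuous fun Y : Matrix (Fin n) (Fin n) ℝ => Y.det := by fun_prop
    have hc2 : Continuous fun Y : Matrix (Fin n) (Fin n) ℝ => Y.adjugate := by fun_prop
    exact (((hc1.tendsto P).comp hN).inv₀ hu.ne_zero).smul ((hc2.tendsto P).comp hN)
  have hQ : Tendsto (fun ε => Q * ((Y0 ε * Q)⁻¹ * P)) l (𝓝 Q) := by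
    have : Continuous fun Y : Matrix (Fin n) (Fin n) ℝ => Q * (Y * P) := by fun_prop
    have h2 := (this.tendsto P⁻¹).comp hinv
    rwa [Matrix.nonsing_inv_mul _ hu, Matrix.mul_one] at h2
  have hc1 : Continuous fun z : Matrix (Fin n) (Fin T) ℝ × Matrix (Fin T) (Fin n) ℝ =>
      fromBlocks (P - α • (z.1 * z.1ᵀ)) (z.1 * z.2) (z.2ᵀ * z.1ᵀ) P := by fun_prop
  have hc2 : Continuous fun z : Matrix (Fin T) (Fin n) ℝ =>
      fromBlocks (1 : Matrix (Fin T) (Fin T) ℝ) z zᵀ P := by fun_prop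
  have e1 := ((hc1.tendsto (X1, Q)).comp (h1.prodMk_nhds hQ)).eventually (aux_posDef_open _ hb1)
  have e2 := ((hc2.tendsto Q).comp hQ).eventually (aux_posDef_open _ hb2)
  filter_upwards [hdet, e1, e2] with ε hd h3 h4
  refine ⟨Q * ((Y0 ε * Q)⁻¹ * P), ?_⟩
  have hXQ : Y0 ε * (Q * ((Y0 ε * Q)⁻¹ * P)) = P := by
    rw [← Matrix.mul_assoc, ← Matrix.mul_assoc, Matrix.mul_nonsing_inv _ (isUnit_iff_ne_zero.mpr hd),
      Matrix.one_mul]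
  rw [AuxFeas, hXQ]
  exact ⟨(h3 (aux_herm1 _ _ _ _ hPT)).posSemidef, (h4 (aux_herm2 _ _ hPT)).posSemidef⟩

/-- Robust decrease. -/
lemma aux_robust {n m T : ℕ} {l : Filter ℝ} (A : Matrix (Fin n) (Fin n) ℝ)
    (B : Matrix (Fin n) (Fin m) ℝ) (U0 : Matrix (Fin m) (Fin T) ℝ)
    (X0 X1 : Matrix (Fin n) (Fin T) ℝ) (hX1 : X1 = A * X0 + B * U0)
    (Y0 Y1 : ℝ → Matrix (Fin n) (Fin T) ℝ) (h0 : Tendsto Y0 l (𝓝 X0)) (h1 : Tendsto Y1 l (𝓝 X1))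
    (hker : ∀ v, v ᵥ* X1 = 0 → v = 0) (α0 : ℝ) (hα0 : 0 < α0) :
    ∀ᶠ ε in l, (∀ v, v ᵥ* Y1 ε = 0 → v = 0) ∧
      ∀ Q α, α0 ≤ α → AuxFeas (Y0 ε) (Y1 ε) Q α → (Y0 ε * Q).PosDef ∧
      ∀ a, a ≠ 0 → ((A + B * (U0 * Q * (Y0 ε * Q)⁻¹))ᵀ *ᵥ a) ⬝ᵥ
        ((Y0 ε * Q) *ᵥ ((A + B * (U0 * Q * (Y0 ε * Q)⁻¹))ᵀ *ᵥ a)) < a ⬝ᵥ ((Y0 ε * Q) *ᵥ a) := by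
  have hgr : (α0 • (X1 * X1ᵀ)).PosDef := by
    refine .of_dotProduct_mulVec_pos ?_ fun x hx => ?_
    · rw [Matrix.IsHermitian, Matrix.conjTranspose_eq_transpose_of_trivial]; simp
    · rw [star_trivial, Matrix.smul_mulVec, dotProduct_smul, aux_gram, smul_eq_mul]
      refine mul_pos hα0 (aux_dot_pos _ fun h => hx (hker x ?_))
      rwa [← Matrix.mulVec_transpose]
  obtain ⟨r, hr, hr1, hrPD⟩ := aux_exists_pos_posDef _ (X0 * X0ᵀ) hgr (by simp)
  have hc : Continuous fun z : Matrix (Fin n) (Fin T) ℝ × Matrix (Fin n) (Fin T) ℝ =>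
      α0 • (z.2 * z.2ᵀ) - r • (z.1 * z.1ᵀ) - r⁻¹ • ((z.2 - (A * z.1 + B * U0)) *
        (z.2 - (A * z.1 + B * U0))ᵀ) := by fun_prop
  have e1 := ((hc.tendsto (X0, X1)).comp (h0.prodMk_nhds h1)).eventually (aux_posDef_open _
    (by simpa [← hX1] using hrPD))
  filter_upwards [e1] with ε he
  set Z0 := Y0 ε
  set Z1 := Y1 ε
  set D := Z1 - (A * Z0 + B * U0) with hD
  have hPD : ∀ a, a ≠ 0 → 0 < α0 * ((Z1ᵀ *ᵥ a) ⬝ᵥ (Z1ᵀ *ᵥ a)) - r * ((Z0ᵀ *ᵥ a) ⬝ᵥ (Z0ᵀ *ᵥ a))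
      - r⁻¹ * ((Dᵀ *ᵥ a) ⬝ᵥ (Dᵀ *ᵥ a)) := by
    intro a ha
    have h2 := (he (by
      rw [Matrix.IsHermitian, Matrix.conjTranspose_eq_transpose_of_trivial]
      simp)).dotProduct_mulVec_pos ha
    simp only [Function.comp] at h2
    rw [star_trivial, Matrix.sub_mulVec, Matrix.sub_mulVec, dotProduct_sub, dotProduct_sub,
      Matrix.smul_mulVec, Matrix.smul_mulVec, Matrix.smul_mulVec, dotProduct_smul, dotProduct_smul,
      dotProduct_smul, aux_gram, aux_gram, aux_gram] at h2
    exact h2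
  have hrinv : 0 < r⁻¹ := inv_pos.mpr hr
  have hZ1 : ∀ a, a ≠ 0 → 0 < (Z1ᵀ *ᵥ a) ⬝ᵥ (Z1ᵀ *ᵥ a) := by
    intro a ha
    have h2 := hPD a ha
    have h3 := mul_nonneg hr.le (aux_dot_nonneg (Z0ᵀ *ᵥ a))
    have h4 := mul_nonneg hrinv.le (aux_dot_nonneg (Dᵀ *ᵥ a))
    exact (mul_pos_iff_of_pos_left hα0).mp (by linarith)
  refine ⟨fun v hv => ?_, fun Q α hα hfeas => ?_⟩
  · by_contra hne
    have h2 := hZ1 v hne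
    rw [Matrix.mulVec_transpose, hv] at h2
    simp at h2
  rw [aux_feas_iff] at hfeas
  obtain ⟨hPT, hl1, hl2⟩ := hfeas
  set P := Z0 * Q with hPdef
  have hPpos : P.PosDef := by
    refine .of_dotProduct_mulVec_pos ?_ fun x hx => ?_
    · rw [Matrix.IsHermitian, Matrix.conjTranspose_eq_transpose_of_trivial, hPT]
    · rw [star_trivial]
      have h2 := hl1 x 0
      have h3 := mul_pos (hα0.trans_le hα) (hZ1 x hx)
      simp at h2
      linarith
  refine ⟨hPpos, fun a ha => ?_⟩
  have hu : IsUnit P.det := (Matrix.isUnit_iff_isUnit_det P).mp hPpos.isUnit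
  have hF : (A + B * (U0 * Q * P⁻¹)) * P = (Z1 - D) * Q := by
    rw [Matrix.add_mul, Matrix.mul_assoc, Matrix.mul_assoc, Matrix.nonsing_inv_mul _ hu,
      Matrix.mul_one, hD, sub_sub_cancel, Matrix.add_mul, hPdef]
    simp only [Matrix.mul_assoc]
  set F := A + B * (U0 * Q * P⁻¹) with hFdef
  set v := Fᵀ *ᵥ a with hv
  have hvP : v ⬝ᵥ (P *ᵥ v) = a ⬝ᵥ ((Z1 * Q) *ᵥ v) - (Dᵀ *ᵥ a) ⬝ᵥ (Q *ᵥ v) := by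
    calc v ⬝ᵥ (P *ᵥ v) = a ⬝ᵥ ((F * P) *ᵥ v) := by
          rw [← Matrix.mulVec_mulVec _ F P, aux_adj F]
      _ = _ := by
          rw [hF, Matrix.sub_mul, Matrix.sub_mulVec, dotProduct_sub, ← Matrix.mulVec_mulVec _ D,
            aux_adj D]
  have k1 := hl1 a (-v)
  have k2 := hl2 (Dᵀ *ᵥ a) (r • v)
  have k3 := hl2 (Z0ᵀ *ᵥ a) (-a)
  have k4 := hPD a ha
  have k5 : α0 * ((Z1ᵀ *ᵥ a) ⬝ᵥ (Z1ᵀ *ᵥ a)) ≤ α * ((Z1ᵀ *ᵥ a) ⬝ᵥ (Z1ᵀ *ᵥ a)) :=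
    mul_le_mul_of_nonneg_right hα (aux_dot_nonneg _)
  have hZQ : (Z0ᵀ *ᵥ a) ⬝ᵥ (Q *ᵥ a) = a ⬝ᵥ (P *ᵥ a) := by
    rw [← aux_adj, Matrix.mulVec_mulVec]
  simp only [Matrix.mulVec_neg, dotProduct_neg, neg_dotProduct, neg_neg, Matrix.mulVec_smul,
    dotProduct_smul, smul_dotProduct, smul_eq_mul, hZQ] at k1 k2 k3
  have hva : 0 ≤ v ⬝ᵥ (P *ᵥ v) := by
    simpa using hPpos.posSemidef.dotProduct_mulVec_nonneg v
  generalize v ⬝ᵥ (P *ᵥ v) = vP at *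
  generalize a ⬝ᵥ (P *ᵥ a) = aP at *
  generalize a ⬝ᵥ ((Z1 * Q) *ᵥ v) = s at *
  generalize (Dᵀ *ᵥ a) ⬝ᵥ (Q *ᵥ v) = d at *
  generalize (Dᵀ *ᵥ a) ⬝ᵥ (Dᵀ *ᵥ a) = dd at *
  generalize (Z0ᵀ *ᵥ a) ⬝ᵥ (Z0ᵀ *ᵥ a) = zz at *
  generalize (Z1ᵀ *ᵥ a) ⬝ᵥ (Z1ᵀ *ᵥ a) = z1 at *
  have k6 : 0 ≤ r⁻¹ * dd + 2 * d + r * vP := by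
    have := mul_nonneg hrinv.le k2
    have e : r⁻¹ * (dd + 2 * (r * d) + r * (r * vP)) = r⁻¹ * dd + 2 * d + r * vP := by
      field_simp
    rwa [e] at this
  have k7 : r * aP ≤ r * zz := mul_le_mul_of_nonneg_left (by linarith) hr.le
  by_contra hcon
  push Not at hcon
  have hr_small := mul_le_mul_of_nonneg_left hcon (sub_pos.mpr hr1).le
  linarith

end helpers

/-- Theorem 4 of the paper: for a controllable linearization and
any experiment with a persistently exciting input of order `n+1`, there exists
`ε̄ > 0` such that for all `ε ∈ (0, ε̄)`, the scaled experiment `(εx₀, εu)` on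
the nonlinear system gives data satisfying Assumption 1, the data LMIs are
feasible with some `α > 0`, and any maximizing feasible pair `(Q*, α*)` yields
an invertible `X̃₀Q*` and a locally exponentially stabilizing gain
`K = Ũ₀Q*(X̃₀Q*)⁻¹`. -/
theorem scaled_experiments_yield_stabilizing_controller
    {n m T : ℕ}
    (f : (Fin n → ℝ) × (Fin m → ℝ) → (Fin n → ℝ))
    (hf : ContDiff ℝ 1 f) (hf0 : f (0, 0) = 0)
    (A : Matrix (Fin n) (Fin n) ℝ) (B : Matrix (Fin n) (Fin m) ℝ)
    (hAB : ∀ xv uv, fderiv ℝ f (0, 0) (xv, uv) = A.mulVec xv + B.mulVec uv)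
    (hctrb : (Matrix.of fun (i : Fin n) (p : Fin n × Fin m) =>
        (A ^ (p.1 : ℕ) * B) i p.2).rank = n)
    (x0 : Fin n → ℝ) (u : ℕ → Fin m → ℝ)
    (hPE : (Matrix.of fun (p : Fin (n + 1) × Fin m) (j : Fin (T - n)) =>
        u ((p.1 : ℕ) + (j : ℕ)) p.2).rank = m * (n + 1))
    (xt : ℝ → ℕ → Fin n → ℝ)
    (hxt0 : ∀ ε : ℝ, xt ε 0 = ε • x0)
    (hxt : ∀ (ε : ℝ) (k : ℕ), xt ε (k + 1) = f (xt ε k, ε • u k))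
    (Ut : ℝ → Matrix (Fin m) (Fin T) ℝ)
    (X0t X1t : ℝ → Matrix (Fin n) (Fin T) ℝ)
    (hUt : ∀ (ε : ℝ) i (j : Fin T), Ut ε i j = ε * u j i)
    (hX0t : ∀ (ε : ℝ) i (j : Fin T), X0t ε i j = xt ε j i)
    (hX1t : ∀ (ε : ℝ) i (j : Fin T), X1t ε i j = xt ε (j + 1) i)
    -- feasibility predicate for the data LMIs built from `(X0t ε, X1t ε)`
    (Feas : ℝ → Matrix (Fin T) (Fin n) ℝ → ℝ → Prop)
    (hFeas : ∀ (ε : ℝ) (Q : Matrix (Fin T) (Fin n) ℝ) (α : ℝ),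
      Feas ε Q α ↔
        (fromBlocks (X0t ε * Q - α • (X1t ε * (X1t ε)ᵀ)) (X1t ε * Q)
          (Qᵀ * (X1t ε)ᵀ) (X0t ε * Q)).PosSemidef ∧
        (fromBlocks (1 : Matrix (Fin T) (Fin T) ℝ) Q
          Qᵀ (X0t ε * Q)).PosSemidef) :
    ∃ εb > (0 : ℝ), ∀ ε ∈ Set.Ioo (0 : ℝ) εb,
      ((fromRows (Ut ε) (X0t ε)).rank = m + n ∧ (X1t ε).rank = n) ∧
      (∃ (Q : Matrix (Fin T) (Fin n) ℝ) (α : ℝ), 0 < α ∧ Feas ε Q α) ∧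
      (∀ (Qs : Matrix (Fin T) (Fin n) ℝ) (αs : ℝ), 0 < αs → Feas ε Qs αs →
        (∀ (Q' : Matrix (Fin T) (Fin n) ℝ) (α' : ℝ), 0 < α' → Feas ε Q' α' →
          α' ≤ αs) →
        IsUnit (X0t ε * Qs) ∧
          ∀ K : Matrix (Fin m) (Fin n) ℝ, K = Ut ε * Qs * (X0t ε * Qs)⁻¹ →
            ∃ δ > (0 : ℝ), ∃ c > (0 : ℝ), ∃ ρ ∈ Set.Ioo (0 : ℝ) 1,
              ∀ z : ℕ → Fin n → ℝ,
                (∀ k, z (k + 1) = f (z k, K.mulVec (z k))) →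
                ‖z 0‖ ≤ δ → ∀ k, ‖z k‖ ≤ c * ρ ^ k * ‖z 0‖) := by
  classical
  -- linearized trajectory
  let xL : ℕ → Fin n → ℝ := fun k => Nat.rec x0 (fun k xk => A *ᵥ xk + B *ᵥ u k) k
  have hxL : ∀ k, xL (k + 1) = A *ᵥ xL k + B *ᵥ u k := fun k => rfl
  have hfd : HasFDerivAt f (fderiv ℝ f (0, 0)) (0, 0) :=
    (hf.differentiable one_ne_zero).differentiableAt.hasFDerivAt
  have hder : ∀ k, HasDerivAt (fun ε => xt ε k) (xL k) 0 ∧ xt 0 k = 0 := by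
    intro k
    induction k with
    | zero =>
      constructor
      · have h1 : (fun ε => xt ε 0) = fun ε : ℝ => ε • x0 := funext hxt0
        rw [h1]
        have h2 : HasDerivAt (fun ε : ℝ => ε • x0) x0 0 := by
          simpa using (hasDerivAt_id (0 : ℝ)).smul_const x0
        exact h2
      · rw [hxt0, zero_smul]
    | succ k ih =>
      obtain ⟨ih1, ih2⟩ := ih
      constructor
      · have h1 : (fun ε => xt ε (k + 1)) = fun ε : ℝ => f (xt ε k, ε • u k) :=
          funext fun ε => hxt ε k
        rw [h1, hxL, ← hAB]
        have h2 : HasDerivAt (fun ε : ℝ => ε • u k) (u k) 0 := by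
          simpa using (hasDerivAt_id (0 : ℝ)).smul_const (u k)
        have h3 := ih1.prodMk h2
        refine HasFDerivAt.comp_hasDerivAt (0 : ℝ) (l := f) ?_ h3
        simp only [ih2, zero_smul]
        exact hfd
      · rw [hxt, ih2, zero_smul, hf0]
  have hlim : ∀ k, Filter.Tendsto (fun ε : ℝ => ε⁻¹ • xt ε k) (nhdsWithin (0 : ℝ) (Set.Ioi 0)) (nhds (xL k)) := by
    intro k
    have h1 := (hasDerivAt_iff_tendsto_slope.mp (hder k).1).mono_left
      (nhdsWithin_mono (0 : ℝ) (show Set.Ioi (0 : ℝ) ⊆ {0}ᶜ from fun x hx => (ne_of_gt hx)))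
    refine h1.congr fun ε => ?_
    simp [slope_def_module, (hder k).2]
  let X0 : Matrix (Fin n) (Fin T) ℝ := Matrix.of fun i j => xL j i
  let X1 : Matrix (Fin n) (Fin T) ℝ := Matrix.of fun i j => xL (j + 1) i
  let U0 : Matrix (Fin m) (Fin T) ℝ := Matrix.of fun i j => u j i
  have hX1 : X1 = A * X0 + B * U0 := by
    ext i j
    change xL (j + 1) i = _
    rw [hxL]
    rfl
  let Y0 : ℝ → Matrix (Fin n) (Fin T) ℝ := fun ε => ε⁻¹ • X0t ε
  let Y1 : ℝ → Matrix (Fin n) (Fin T) ℝ := fun ε => ε⁻¹ • X1t ε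
  have hY0 : Filter.Tendsto Y0 (nhdsWithin (0 : ℝ) (Set.Ioi 0)) (nhds X0) := by
    refine tendsto_pi_nhds.mpr fun i => tendsto_pi_nhds.mpr fun j => ?_
    refine ((tendsto_pi_nhds.mp (hlim j)) i).congr fun ε => ?_
    simp [Y0, hX0t]
  have hY1 : Filter.Tendsto Y1 (nhdsWithin (0 : ℝ) (Set.Ioi 0)) (nhds X1) := by
    refine tendsto_pi_nhds.mpr fun i => tendsto_pi_nhds.mpr fun j => ?_
    refine ((tendsto_pi_nhds.mp (hlim (j + 1))) i).congr fun ε => ?_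
    simp [Y1, hX1t]
  -- full rank of the linear data
  have hkerM : ∀ v, v ᵥ* fromRows U0 X0 = 0 → v = 0 := by
    intro v hv
    obtain ⟨hξ, hη⟩ := aux_willems A B hctrb u hPE xL hxL (v ∘ Sum.inr) (v ∘ Sum.inl) (by
      intro k hk
      have h1 := congrFun hv ⟨k, hk⟩
      rw [Matrix.vecMul_fromRows] at h1
      rw [add_comm]
      exact h1)
    ext i
    cases i with
    | inl i => exact congrFun hη i
    | inr i => exact congrFun hξ i
  obtain ⟨G, hG⟩ := aux_rank_right_inv _ (aux_ker_rank _ hkerM)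
  have hkerX1 : ∀ v, v ᵥ* X1 = 0 → v = 0 := by
    intro v hv
    have h1 : Sum.elim (v ᵥ* B) (v ᵥ* A) ᵥ* fromRows U0 X0 = 0 := by
      rw [Matrix.vecMul_fromRows, Sum.elim_comp_inl, Sum.elim_comp_inr, Matrix.vecMul_vecMul,
        Matrix.vecMul_vecMul, ← Matrix.vecMul_add, add_comm, ← hX1, hv]
    have h2 := hkerM _ h1
    exact aux_ctrb_ker A B hctrb v (funext fun i => congrFun h2 (Sum.inr i))
      (funext fun i => congrFun h2 (Sum.inl i))
  obtain ⟨Q, α0, hα0, hQ1, hQ2, hQ3⟩ := aux_strict A B hctrb U0 X0 X1 hX1 G hG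
  have ev1 := aux_perturb X0 X1 Y0 Y1 hY0 hY1 Q α0 hQ1 hQ2 hQ3
  have ev2 := aux_robust A B U0 X0 X1 hX1 Y0 Y1 hY0 hY1 hkerX1 α0 hα0
  have ev3 : ∀ᶠ ε in nhdsWithin (0 : ℝ) (Set.Ioi 0), (fromRows U0 (Y0 ε) * G).det ≠ 0 := by
    have hc : Continuous fun Y : Matrix (Fin n) (Fin T) ℝ => (fromRows U0 Y * G).det := by
      have h1 : Continuous fun Y : Matrix (Fin n) (Fin T) ℝ => fromRows U0 Y := by
        refine continuous_matrix fun i j => ?_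
        cases i with
        | inl i => exact continuous_const
        | inr i => exact continuous_id.matrix_elem i j
      fun_prop
    exact ((hc.tendsto X0).comp hY0).eventually_ne (by rw [hG]; simp)
  obtain ⟨εb, hεb, hall⟩ := (mem_nhdsGT_iff_exists_Ioo_subset).mp
    ((ev1.and ev2).and ev3)
  refine ⟨εb, hεb, fun ε hε => ?_⟩
  obtain ⟨⟨h1, h2, h3⟩, h4⟩ := hall hε
  have hε0 : ε ≠ 0 := hε.1.ne'
  have eX0 : X0t ε = ε • Y0 ε := by simp [Y0, smul_smul, hε0]
  have eX1 : X1t ε = ε • Y1 ε := by simp [Y1, smul_smul, hε0]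
  have eU : Ut ε = ε • U0 := by
    ext i j
    simp [hUt, U0]
  have hF : ∀ Q α, Feas ε Q α ↔ AuxFeas (X0t ε) (X1t ε) Q α := fun Q α => hFeas ε Q α
  obtain ⟨Qh, hQh⟩ := h1
  have hfe : Feas ε (ε • Qh) α0 := by
    rw [hF, eX0, eX1]
    exact aux_feas_scale _ _ _ _ _ hQh
  refine ⟨⟨?_, ?_⟩, ⟨ε • Qh, α0, hα0, hfe⟩, ?_⟩
  · rw [aux_ker_rank]
    · simp
    intro v hv
    have e1 : fromRows (Ut ε) (X0t ε) = ε • fromRows U0 (Y0 ε) := by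
      rw [eU, eX0]
      ext i j
      cases i <;> rfl
    rw [e1, Matrix.vecMul_smul] at hv
    have e2 := (smul_eq_zero.mp hv).resolve_left hε0
    refine aux_right_inv_ker _ (G * (fromRows U0 (Y0 ε) * G)⁻¹) ?_ v e2
    rw [← Matrix.mul_assoc, Matrix.mul_nonsing_inv _ (isUnit_iff_ne_zero.mpr h4)]
  · rw [aux_ker_rank]
    · simp
    intro v hv
    rw [eX1, Matrix.vecMul_smul] at hv
    exact h2 v ((smul_eq_zero.mp hv).resolve_left hε0)
  intro Qs αs hαs hfs hmax
  have hle : α0 ≤ αs := hmax _ _ hα0 hfe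
  have hfs' : AuxFeas (Y0 ε) (Y1 ε) (ε⁻¹ • Qs) αs := by
    rw [hF] at hfs
    exact aux_feas_scale _ _ _ _ _ hfs
  obtain ⟨hPD, hdec⟩ := h3 _ _ hle hfs'
  have hXQ : X0t ε * Qs = (ε ^ 2) • (Y0 ε * (ε⁻¹ • Qs)) := by
    rw [eX0, Matrix.mul_smul, Matrix.smul_mul, smul_smul]
    congr 1
    field_simp
  set P := Y0 ε * (ε⁻¹ • Qs) with hPdef
  have hu : IsUnit P.det := (Matrix.isUnit_iff_isUnit_det P).mp hPD.isUnit
  have hPD2 : (X0t ε * Qs).PosDef := by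
    rw [hXQ]; exact hPD.smul (by positivity)
  refine ⟨hPD2.isUnit, ?_⟩
  intro K hK
  have hinv : (X0t ε * Qs)⁻¹ = (ε ^ 2)⁻¹ • P⁻¹ := by
    rw [hXQ]
    refine Matrix.inv_eq_left_inv ?_
    rw [Matrix.smul_mul, Matrix.mul_smul, smul_smul, Matrix.nonsing_inv_mul _ hu,
      inv_mul_cancel₀ (pow_ne_zero 2 hε0), one_smul]
  have hK2 : K = U0 * (ε⁻¹ • Qs) * P⁻¹ := by
    rw [hK, hinv, eU]
    simp only [Matrix.smul_mul, Matrix.mul_smul, smul_smul]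
    congr 1
    field_simp
  rw [← hK2] at hdec
  obtain ⟨hS1, hS2⟩ := aux_dual P (A + B * K) hPD hdec
  refine aux_stab (fun x => f (x, K *ᵥ x)) (A + B * K) P⁻¹ ?_ hS1 hS2
  -- linearization of the closed loop
  let ι : (Fin n → ℝ) →L[ℝ] (Fin n → ℝ) × (Fin m → ℝ) :=
    (ContinuousLinearMap.id ℝ _).prod (LinearMap.toContinuousLinearMap K.mulVecLin)
  have hι : ∀ x, ι x = (x, K *ᵥ x) := fun x => rfl
  have hcomp : HasFDerivAt (fun x => f (ι x)) ((fderiv ℝ f (0, 0)).comp ι) 0 := by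
    refine HasFDerivAt.comp (0 : Fin n → ℝ) (g := f) ?_ ι.hasFDerivAt
    rw [map_zero]
    exact hfd
  have hlo := hcomp.isLittleO
  refine (hlo.congr (fun x => ?_) (fun x => ?_))
  · rw [map_zero, show f 0 = 0 from hf0, sub_zero, sub_zero, ContinuousLinearMap.comp_apply, hι,
      hAB, Matrix.add_mulVec, Matrix.mulVec_mulVec]
  · rw [sub_zero]
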